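/- Let L ∈ ℕ, let v_0, …, v_L and w_0, …, w_L be positive real numbers, let ε > 0, and set S = Σ_{k=0}^L √(v_k w_k). Define the integer sample sizes N_ℓ = ⌈ ε^{-2} √(v_ℓ / w_ℓ) · S ⌉ for ℓ = 0, …, L. Then Σ_{ℓ=0}^L v_ℓ / N_ℓ ≤ ε², and the total work satisfies Σ_{ℓ=0}^L N_ℓ w_ℓ ≤ ε^{-2} S² + Σ_{ℓ=0}^L w_ℓ. -/

import Mathlib

/-- Integer (ceiling) multilevel sample allocation: the variance constraint
still holds and the total work exceeds the optimum by at most `∑ w_ℓ`. -/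
theorem mlmc_ceiling_allocation
    (L : ℕ) (v w : Fin (L + 1) → ℝ) (hv : ∀ ℓ, 0 < v ℓ) (hw : ∀ ℓ, 0 < w ℓ)
    (ε : ℝ) (hε : 0 < ε) (S : ℝ) (hS : S = ∑ k, Real.sqrt (v k * w k))
    (N : Fin (L + 1) → ℕ)
    (hN : ∀ ℓ, N ℓ = ⌈(ε ^ 2)⁻¹ * Real.sqrt (v ℓ / w ℓ) * S⌉₊) :
    (∑ ℓ, v ℓ / (N ℓ : ℝ) ≤ ε ^ 2) ∧
    (∑ ℓ, (N ℓ : ℝ) * w ℓ ≤ (ε ^ 2)⁻¹ * S ^ 2 + ∑ ℓ, w ℓ) := by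
  have hS_pos : 0 < S := by
    rw [hS]
    exact Finset.sum_pos (fun k _ => Real.sqrt_pos.mpr (mul_pos (hv k) (hw k)))
      Finset.univ_nonempty
  have hdiv : ∀ ℓ, Real.sqrt (v ℓ / w ℓ) = Real.sqrt (v ℓ * w ℓ) / w ℓ := fun ℓ => by
    have h : v ℓ / w ℓ = v ℓ * w ℓ / w ℓ ^ 2 := by
      have := (hw ℓ).ne'
      field_simp
    rw [h, Real.sqrt_div (mul_pos (hv ℓ) (hw ℓ)).le, Real.sqrt_sq (hw ℓ).le]
  have hx_pos : ∀ ℓ, 0 < (ε ^ 2)⁻¹ * Real.sqrt (v ℓ / w ℓ) * S := fun ℓ => by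
    have := Real.sqrt_pos.mpr (div_pos (hv ℓ) (hw ℓ))
    positivity
  constructor
  · calc ∑ ℓ, v ℓ / (N ℓ : ℝ)
        ≤ ∑ ℓ, ε ^ 2 / S * Real.sqrt (v ℓ * w ℓ) := by
          refine Finset.sum_le_sum fun ℓ _ => ?_
          calc v ℓ / (N ℓ : ℝ)
              ≤ v ℓ / ((ε ^ 2)⁻¹ * Real.sqrt (v ℓ / w ℓ) * S) := by
                rw [hN ℓ]
                exact div_le_div_of_nonneg_left (hv ℓ).le (hx_pos ℓ) (Nat.le_ceil _)
            _ = ε ^ 2 / S * Real.sqrt (v ℓ * w ℓ) := by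
                have hs := Real.sqrt_pos.mpr (mul_pos (hv ℓ) (hw ℓ))
                have hsq := Real.sq_sqrt (mul_pos (hv ℓ) (hw ℓ)).le
                have hw' := (hw ℓ).ne'
                rw [hdiv ℓ]
                field_simp
                linarith
      _ = ε ^ 2 := by
          rw [← Finset.mul_sum, ← hS]
          field_simp
  · calc ∑ ℓ, (N ℓ : ℝ) * w ℓ
        ≤ ∑ ℓ, ((ε ^ 2)⁻¹ * S * Real.sqrt (v ℓ * w ℓ) + w ℓ) := by
          refine Finset.sum_le_sum fun ℓ _ => ?_
          calc (N ℓ : ℝ) * w ℓ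
              ≤ ((ε ^ 2)⁻¹ * Real.sqrt (v ℓ / w ℓ) * S + 1) * w ℓ := by
                rw [hN ℓ]
                exact mul_le_mul_of_nonneg_right (Nat.ceil_lt_add_one (hx_pos ℓ).le).le (hw ℓ).le
            _ = (ε ^ 2)⁻¹ * S * Real.sqrt (v ℓ * w ℓ) + w ℓ := by
                have hw' := (hw ℓ).ne'
                rw [hdiv ℓ]
                field_simp
      _ = (ε ^ 2)⁻¹ * S ^ 2 + ∑ ℓ, w ℓ := by
          rw [Finset.sum_add_distrib, ← Finset.mul_sum, ← hS]
          ring
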